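/- Let p ≥ 1 and n ≥ p + 2. Then there exist constants κ₁ > 0, κ₂, κ₃ ∈ ℝ, depending only on n and p, such that for every z ∈ ℝ^p: ∫_{ℝ^{p×p}} ∫_{ℝ^p} ‖a + B z‖⁴ · exp( −(n/2)‖a‖² − (n/2)·tr(B′B) ) · |det B|^{n−p−1} da dB = κ₁·‖z‖⁴ + κ₂·‖z‖² + κ₃, where da and dB are Lebesgue measures on ℝ^p and ℝ^{p×p} and ‖·‖ is the Euclidean norm. Consequently, for z₁,…,zₙ ∈ ℝ^p with Σᵢ zᵢ = 0 and Σᵢ zᵢzᵢ′ = n I_p, the sum Σ_{i=1}^n of these integrals equals κ₁·Σ_{i=1}^n ‖zᵢ‖⁴ plus a constant depending only on n and p, so the locally best invariant test of multivariate normality under the full affine group ℝ^p × GL(p), when the score function is ℓ(x) = p₀‖x‖⁴ + p₁‖x‖² + p₂ with p₀ > 0, rejects for large Σᵢ ‖zᵢ‖⁴. -/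

import Mathlib

open MeasureTheory
open scoped Matrix

/-- The LBI integral for score `‖x‖⁴` under the full affine group:
`I(z) = ∫_{ℝ^{p×p}} ∫_{ℝ^p} ‖a + Bz‖⁴ exp(-(n/2)‖a‖² - (n/2)tr(B'B)) |det B|^{n-p-1} da dB`,
with the Euclidean norm written out as `‖v‖² = ∑ⱼ vⱼ²`. -/
noncomputable def affineLbiIntegral (p n : ℕ) (z : Fin p → ℝ) : ℝ :=
  ∫ B : Fin p → Fin p → ℝ, ∫ a : Fin p → ℝ,
    (∑ j, (a j + (Matrix.of B).mulVec z j) ^ 2) ^ 2 *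
      Real.exp (-((n : ℝ) / 2) * (∑ j, (a j) ^ 2)
        - ((n : ℝ) / 2) * Matrix.trace ((Matrix.of B)ᵀ * Matrix.of B)) *
      |(Matrix.of B).det| ^ (n - p - 1)

/-- A continuous real function bounded by a polynomial in the norm. -/
def PolyGrowth {E : Type*} [SeminormedAddCommGroup E] (f : E → ℝ) : Prop :=
  Continuous f ∧ ∃ (C : ℝ) (k : ℕ), 0 ≤ C ∧ ∀ x, |f x| ≤ C * (1 + ‖x‖) ^ k

namespace PolyGrowth

variable {E : Type*} [SeminormedAddCommGroup E] {f g : E → ℝ}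

theorem const (c : ℝ) : PolyGrowth (fun _ : E => c) :=
  ⟨continuous_const, |c|, 0, abs_nonneg c, fun x => by simp⟩

theorem of_abs_le_norm (hf : Continuous f) (h : ∀ x, |f x| ≤ ‖x‖) : PolyGrowth f :=
  ⟨hf, 1, 1, zero_le_one, fun x => by linarith [h x]⟩

theorem mul (hf : PolyGrowth f) (hg : PolyGrowth g) : PolyGrowth (fun x => f x * g x) := by
  obtain ⟨hf, C, k, hC, hfb⟩ := hf
  obtain ⟨hg, D, l, hD, hgb⟩ := hg
  refine ⟨hf.mul hg, C * D, k + l, by positivity, fun x => ?_⟩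
  calc |f x * g x| = |f x| * |g x| := abs_mul _ _
    _ ≤ (C * (1 + ‖x‖) ^ k) * (D * (1 + ‖x‖) ^ l) :=
        mul_le_mul (hfb x) (hgb x) (abs_nonneg _) (by positivity)
    _ = C * D * (1 + ‖x‖) ^ (k + l) := by ring

theorem add (hf : PolyGrowth f) (hg : PolyGrowth g) : PolyGrowth (fun x => f x + g x) := by
  obtain ⟨hf, C, k, hC, hfb⟩ := hf
  obtain ⟨hg, D, l, hD, hgb⟩ := hg
  refine ⟨hf.add hg, C + D, k + l, by positivity, fun x => ?_⟩
  have h1 : (1 : ℝ) ≤ 1 + ‖x‖ := by linarith [norm_nonneg x]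
  have hk : (1 + ‖x‖) ^ k ≤ (1 + ‖x‖) ^ (k + l) := pow_le_pow_right₀ h1 (by omega)
  have hl : (1 + ‖x‖) ^ l ≤ (1 + ‖x‖) ^ (k + l) := pow_le_pow_right₀ h1 (by omega)
  calc |f x + g x| ≤ |f x| + |g x| := abs_add_le _ _
    _ ≤ C * (1 + ‖x‖) ^ k + D * (1 + ‖x‖) ^ l := add_le_add (hfb x) (hgb x)
    _ ≤ C * (1 + ‖x‖) ^ (k + l) + D * (1 + ‖x‖) ^ (k + l) := by gcongr
    _ = (C + D) * (1 + ‖x‖) ^ (k + l) := by ring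

theorem abs (hf : PolyGrowth f) : PolyGrowth (fun x => |f x|) := by
  obtain ⟨hf, C, k, hC, hfb⟩ := hf
  exact ⟨hf.abs, C, k, hC, fun x => by simpa using hfb x⟩

theorem pow (hf : PolyGrowth f) (m : ℕ) : PolyGrowth (fun x => f x ^ m) := by
  induction m with
  | zero => simpa using const 1
  | succ m ih => simpa only [pow_succ] using ih.mul hf

theorem sum {ι : Type*} (s : Finset ι) {F : ι → E → ℝ} (h : ∀ i, PolyGrowth (F i)) :
    PolyGrowth (fun x => ∑ i ∈ s, F i x) := by
  classical
  induction s using Finset.induction_on with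
  | empty => simpa using const 0
  | insert i s hi ih => simpa only [Finset.sum_insert hi] using (h i).add ih

theorem prod {ι : Type*} (s : Finset ι) {F : ι → E → ℝ} (h : ∀ i, PolyGrowth (F i)) :
    PolyGrowth (fun x => ∏ i ∈ s, F i x) := by
  classical
  induction s using Finset.induction_on with
  | empty => simpa using const 1
  | insert i s hi ih => simpa only [Finset.prod_insert hi] using (h i).mul ih

theorem det {p : ℕ} {B : E → Fin p → Fin p → ℝ} (h : ∀ i j, PolyGrowth (fun x => B x i j)) :
    PolyGrowth (fun x => (Matrix.of (B x)).det) := by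
  simp only [Matrix.det_apply', Matrix.of_apply]
  exact sum _ fun σ => (const _).mul (prod _ fun i => h _ _)

end PolyGrowth

theorem one_add_pow_mul_exp_neg_sq_le {c : ℝ} (hc : 0 < c) (k : ℕ) {r : ℝ} (hr : 0 ≤ r) :
    (1 + r) ^ k * Real.exp (-c * r ^ 2) ≤ k.factorial * Real.exp (1 + 1 / (4 * c)) := by
  have h1 : (1 + r) ^ k ≤ k.factorial * Real.exp (1 + r) := by
    have := Real.pow_div_factorial_le_exp (1 + r) (by linarith) k
    rwa [div_le_iff₀' (by positivity)] at this
  calc (1 + r) ^ k * Real.exp (-c * r ^ 2)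
      ≤ k.factorial * Real.exp (1 + r) * Real.exp (-c * r ^ 2) := by gcongr
    _ = k.factorial * Real.exp (1 + r + -c * r ^ 2) := by rw [mul_assoc, ← Real.exp_add]
    _ ≤ k.factorial * Real.exp (1 + 1 / (4 * c)) := by
        refine mul_le_mul_of_nonneg_left (Real.exp_le_exp.mpr ?_) (by positivity)
        have : 1 / (4 * c) - (r + -c * r ^ 2) = c * (r - 1 / (2 * c)) ^ 2 := by
          field_simp; ring
        have : 0 ≤ c * (r - 1 / (2 * c)) ^ 2 := by positivity
        linarith

theorem integrable_exp_neg_mul_sum_sq {ι : Type*} [Fintype ι] {c : ℝ} (hc : 0 < c) :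
    Integrable (fun a : ι → ℝ => Real.exp (-c * ∑ j, a j ^ 2)) := by
  simp only [Finset.mul_sum, Real.exp_sum]
  exact Integrable.fintype_prod (f := fun _ (t : ℝ) => Real.exp (-c * t ^ 2))
    fun _ => integrable_exp_neg_mul_sq hc

theorem integrable_exp_neg_mul_sum_sum_sq {ι κ : Type*} [Fintype ι] [Fintype κ] {c : ℝ}
    (hc : 0 < c) :
    Integrable (fun B : ι → κ → ℝ => Real.exp (-c * ∑ i, ∑ j, B i j ^ 2)) := by
  simp only [Finset.mul_sum (s := (Finset.univ : Finset ι)), Real.exp_sum]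
  exact Integrable.fintype_prod (f := fun _ (b : κ → ℝ) => Real.exp (-c * ∑ j, b j ^ 2))
    fun _ => integrable_exp_neg_mul_sum_sq hc

theorem sq_norm_le_sum_sq {ι : Type*} [Fintype ι] {E : ι → Type*}
    [∀ i, SeminormedAddCommGroup (E i)] (a : ∀ i, E i) : ‖a‖ ^ 2 ≤ ∑ j, ‖a j‖ ^ 2 := by
  have hs : 0 ≤ ∑ j, ‖a j‖ ^ 2 := by positivity
  rw [← Real.le_sqrt (norm_nonneg _) hs, pi_norm_le_iff_of_nonneg (Real.sqrt_nonneg _)]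
  intro i
  apply Real.le_sqrt_of_sq_le
  exact Finset.single_le_sum (f := fun j => ‖a j‖ ^ 2) (fun _ _ => by positivity)
    (Finset.mem_univ i)

theorem sq_norm_prod_le {ι κ μ : Type*} [Fintype ι] [Fintype κ] [Fintype μ]
    (x : (ι → κ → ℝ) × (μ → ℝ)) :
    ‖x‖ ^ 2 ≤ ∑ j, x.2 j ^ 2 + ∑ i, ∑ j, x.1 i j ^ 2 := by
  have h2 : ‖x.2‖ ^ 2 ≤ ∑ j, x.2 j ^ 2 := by simpa using sq_norm_le_sum_sq x.2
  have h1 : ‖x.1‖ ^ 2 ≤ ∑ i, ∑ j, x.1 i j ^ 2 :=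
    (sq_norm_le_sum_sq x.1).trans
      (Finset.sum_le_sum fun i _ => by simpa using sq_norm_le_sum_sq (x.1 i))
  rw [Prod.norm_def]
  rcases max_cases ‖x.1‖ ‖x.2‖ with h | h <;> rw [h.1] <;> nlinarith

/-- The parameter space of pairs `(B, a)`, where `B` is the linear part and `a` the translation. -/
abbrev AffineParam (p : ℕ) : Type := (Fin p → Fin p → ℝ) × (Fin p → ℝ)

/-- The Gaussian weight `exp (-c ‖a‖² - c ‖B‖²)`, with the Frobenius norm of `B`. -/
noncomputable def gaussianWeight (p : ℕ) (c : ℝ) (x : AffineParam p) : ℝ :=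
  Real.exp (-c * (∑ j, x.2 j ^ 2) - c * Matrix.trace ((Matrix.of x.1)ᵀ * Matrix.of x.1))

theorem trace_transpose_mul_self_eq_sum_sq {p : ℕ} (B : Fin p → Fin p → ℝ) :
    Matrix.trace ((Matrix.of B)ᵀ * Matrix.of B) = ∑ i, ∑ j, B i j ^ 2 := by
  simp only [Matrix.trace, Matrix.diag, Matrix.mul_apply, Matrix.transpose_apply,
    Matrix.of_apply, ← pow_two]
  exact Finset.sum_comm

theorem continuous_gaussianWeight (p : ℕ) (c : ℝ) : Continuous (gaussianWeight p c) := by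
  unfold gaussianWeight
  simp only [trace_transpose_mul_self_eq_sum_sq]
  fun_prop

theorem PolyGrowth.integrable_mul_gaussianWeight {p : ℕ}
    {f : AffineParam p → ℝ} (hf : PolyGrowth f) {c : ℝ} (hc : 0 < c) :
    Integrable (fun x => f x * gaussianWeight p c x) := by
  obtain ⟨hf, C, k, hC, hfb⟩ := hf
  have hc2 : 0 < c / 2 := by positivity
  have hint := ((integrable_exp_neg_mul_sum_sum_sq (ι := Fin p) (κ := Fin p) hc2).mul_prod
    (integrable_exp_neg_mul_sum_sq (ι := Fin p) hc2)).const_mul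
      (C * (k.factorial * Real.exp (1 + 1 / (4 * (c / 2)))))
  refine Integrable.mono' hint
    (hf.mul (continuous_gaussianWeight p c)).aestronglyMeasurable (.of_forall fun x => ?_)
  have hs := sq_norm_prod_le x
  have hw : gaussianWeight p c x ≤ Real.exp (-(c / 2) * ‖x‖ ^ 2) *
      (Real.exp (-(c / 2) * ∑ i, ∑ j, x.1 i j ^ 2) * Real.exp (-(c / 2) * ∑ j, x.2 j ^ 2)) := by
    rw [gaussianWeight, trace_transpose_mul_self_eq_sum_sq, ← Real.exp_add, ← Real.exp_add]
    apply Real.exp_le_exp.mpr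
    nlinarith
  rw [norm_mul, Real.norm_eq_abs, Real.norm_of_nonneg (by unfold gaussianWeight; positivity)]
  calc |f x| * gaussianWeight p c x
      ≤ (C * (1 + ‖x‖) ^ k) * (Real.exp (-(c / 2) * ‖x‖ ^ 2) *
      (Real.exp (-(c / 2) * ∑ i, ∑ j, x.1 i j ^ 2) *
        Real.exp (-(c / 2) * ∑ j, x.2 j ^ 2))) :=
        mul_le_mul (hfb x) hw (by unfold gaussianWeight; positivity) (by positivity)
    _ = C * ((1 + ‖x‖) ^ k * Real.exp (-(c / 2) * ‖x‖ ^ 2)) *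
      (Real.exp (-(c / 2) * ∑ i, ∑ j, x.1 i j ^ 2) *
        Real.exp (-(c / 2) * ∑ j, x.2 j ^ 2)) := by ring
    _ ≤ _ := by
        refine mul_le_mul_of_nonneg_right (mul_le_mul_of_nonneg_left ?_ hC) (by positivity)
        exact one_add_pow_mul_exp_neg_sq_le hc2 k (norm_nonneg x)

/-- Householder reflection: two real vectors of the same length are exchanged by a symmetric
orthogonal matrix. -/
theorem exists_symm_orthogonal_mulVec_eq {ι : Type*} [Fintype ι] [DecidableEq ι] {x y : ι → ℝ}
    (h : x ⬝ᵥ x = y ⬝ᵥ y) :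
    ∃ H : Matrix ι ι ℝ, Hᵀ = H ∧ H * H = 1 ∧ H *ᵥ x = y := by
  by_cases hxy : x = y
  · exact ⟨1, by simp, by simp, by simp [hxy]⟩
  set u := x - y with hu
  have hu0 : u ⬝ᵥ u ≠ 0 := by
    rw [Ne, dotProduct_self_eq_zero]
    exact sub_ne_zero.mpr hxy
  have hux : u ⬝ᵥ u = 2 * (u ⬝ᵥ x) := by
    simp only [hu, sub_dotProduct, dotProduct_sub, h, dotProduct_comm y x]
    ring
  refine ⟨1 - (2 / (u ⬝ᵥ u)) • Matrix.vecMulVec u u, ?_, ?_, ?_⟩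
  · simp [Matrix.transpose_vecMulVec]
  · have hV : Matrix.vecMulVec u u * Matrix.vecMulVec u u
        = (u ⬝ᵥ u) • Matrix.vecMulVec u u := by
      rw [Matrix.vecMulVec_mul_vecMulVec]
      ext i j
      simp [Matrix.vecMulVec_apply]
      ring
    simp only [sub_mul, mul_sub, Matrix.smul_mul, Matrix.mul_smul, hV, smul_smul, one_mul, mul_one]
    have : 2 / (u ⬝ᵥ u) * (2 / (u ⬝ᵥ u) * (u ⬝ᵥ u)) = 2 / (u ⬝ᵥ u) + 2 / (u ⬝ᵥ u) := by
      field_simp; ring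
    rw [this, add_smul]
    abel
  · have hval : 2 / (u ⬝ᵥ u) * (u ⬝ᵥ x) = 1 := by
      rw [div_mul_eq_mul_div, ← hux, div_self hu0]
    ext i
    rw [Matrix.sub_mulVec, Matrix.one_mulVec, Matrix.smul_mulVec, Matrix.vecMulVec_mulVec]
    have : 2 / (u ⬝ᵥ u) * (u i * (u ⬝ᵥ x)) = x i - y i := by
      calc _ = (2 / (u ⬝ᵥ u) * (u ⬝ᵥ x)) * u i := by ring
        _ = _ := by rw [hval, hu]; simp
    simp only [Pi.sub_apply, Pi.smul_apply, smul_eq_mul]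
    simp only [MulOpposite.smul_eq_mul_unop, MulOpposite.unop_op]
    linarith

theorem measurePreserving_mul_of_mul_self_eq_one {p : ℕ} {H : Matrix (Fin p) (Fin p) ℝ}
    (hH : H * H = 1) :
    MeasurePreserving (fun B : Fin p → Fin p → ℝ => fun i => H *ᵥ B i) := by
  have hdet : H.det * H.det = 1 := by rw [← Matrix.det_mul, hH, Matrix.det_one]
  have hdet0 : H.det ≠ 0 := fun h => by simp [h] at hdet
  have habs : |H.det⁻¹| = 1 := by
    rw [abs_inv, inv_eq_one]
    rcases mul_self_eq_one_iff.mp hdet with h | h <;> simp [h]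
  refine volume_preserving_pi fun _ => ⟨?_, ?_⟩
  · exact (Matrix.toLin' H).continuous_of_finiteDimensional.measurable
  · have := Real.map_matrix_volume_pi_eq_smul_volume_pi hdet0
    rw [habs, ENNReal.ofReal_one, one_smul] at this
    exact this

theorem affineLbiIntegral_mulVec {p n : ℕ} {H : Matrix (Fin p) (Fin p) ℝ} (hsymm : Hᵀ = H)
    (hH : H * H = 1) (z : Fin p → ℝ) :
    affineLbiIntegral p n (H *ᵥ z) = affineLbiIntegral p n z := by
  have hmp := measurePreserving_mul_of_mul_self_eq_one hH
  have hinv : ∀ v, H *ᵥ (H *ᵥ v) = v := fun v => by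
    rw [Matrix.mulVec_mulVec, hH, Matrix.one_mulVec]
  have hemb : MeasurableEmbedding (fun B : Fin p → Fin p → ℝ => fun i => H *ᵥ B i) := by
    refine Continuous.measurableEmbedding ?_ ?_
    · exact continuous_pi fun i =>
        (Matrix.toLin' H).continuous_of_finiteDimensional.comp (continuous_apply i)
    · intro B C hBC
      funext i
      rw [← hinv (B i), ← hinv (C i)]
      exact congrArg (H *ᵥ ·) (congrFun hBC i)
  have hof : ∀ B : Fin p → Fin p → ℝ,
      Matrix.of (fun i => H *ᵥ B i) = Matrix.of B * H := fun B => by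
    ext i j
    simp only [Matrix.of_apply, Matrix.mul_apply, Matrix.mulVec, dotProduct]
    refine Finset.sum_congr rfl fun k _ => ?_
    rw [mul_comm, ← hsymm, Matrix.transpose_apply, hsymm]
  have hdet : |H.det| = 1 := by
    have hdet : H.det * H.det = 1 := by rw [← Matrix.det_mul, hH, Matrix.det_one]
    rcases mul_self_eq_one_iff.mp hdet with h | h <;> simp [h]
  unfold affineLbiIntegral
  rw [← hmp.integral_comp hemb]
  congr 1
  funext B
  rw [hof, Matrix.mulVec_mulVec, mul_assoc, hH, mul_one, Matrix.det_mul, abs_mul, hdet, mul_one,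
    Matrix.transpose_mul, hsymm, Matrix.trace_mul_comm, mul_assoc, ← mul_assoc H H, hH, one_mul,
    Matrix.trace_mul_comm]

theorem integral_eq_zero_of_odd_snd {p : ℕ} {f : AffineParam p → ℝ}
    (hf : Integrable f) (hodd : ∀ B a, f (B, -a) = -f (B, a)) : ∫ x, f x = 0 := by
  have hinner : ∀ B, ∫ a, f (B, a) = 0 := fun B => by
    have h := integral_neg_eq_self (fun a => f (B, a)) volume
    simp only [hodd, integral_neg] at h
    linarith
  rw [Measure.volume_eq_prod] at hf ⊢
  rw [integral_prod _ hf]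
  simp [hinner]

/-- The integral at a multiple `t` of a basis vector is an even quartic polynomial in `t`. -/
theorem exists_affineLbiIntegral_single {p n : ℕ} (hn : 0 < n) (j₀ : Fin p) :
    ∃ κ₁ κ₂ κ₃ : ℝ, 0 < κ₁ ∧ ∀ t : ℝ,
      affineLbiIntegral p n (Pi.single j₀ t) = κ₁ * t ^ 4 + κ₂ * t ^ 2 + κ₃ := by
  have hc : 0 < (n : ℝ) / 2 := by positivity
  let d : AffineParam p → ℝ := fun x => |(Matrix.of x.1).det| ^ (n - p - 1)
  let A : AffineParam p → ℝ := fun x => ∑ j, x.2 j ^ 2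
  let D : AffineParam p → ℝ := fun x => ∑ j, x.2 j * x.1 j j₀
  let S : AffineParam p → ℝ := fun x => ∑ j, x.1 j j₀ ^ 2
  let w : AffineParam p → ℝ := gaussianWeight p ((n : ℝ) / 2)
  have ha : ∀ j, PolyGrowth (fun x : AffineParam p => x.2 j) := fun j =>
    .of_abs_le_norm (by fun_prop) fun x => (norm_le_pi_norm x.2 j).trans (le_max_right _ _)
  have hB : ∀ i j, PolyGrowth (fun x : AffineParam p => x.1 i j) := fun i j =>
    .of_abs_le_norm (by fun_prop) fun x =>
      ((norm_le_pi_norm (x.1 i) j).trans (norm_le_pi_norm x.1 i)).trans (le_max_left _ _)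
  have hd : PolyGrowth d := (PolyGrowth.det hB).abs.pow _
  have hA : PolyGrowth A := .sum _ fun j => (ha j).pow 2
  have hD : PolyGrowth D := .sum _ fun j => (ha j).mul (hB j j₀)
  have hS : PolyGrowth S := .sum _ fun j => (hB j j₀).pow 2
  have hint : ∀ {f : AffineParam p → ℝ}, PolyGrowth f → Integrable (fun x => f x * d x * w x) :=
    fun hf => (hf.mul hd).integrable_mul_gaussianWeight hc
  have h4 := hint (hS.pow 2)
  have h3 := hint (hD.mul hS)
  have h2 := hint (((PolyGrowth.const 4).mul (hD.pow 2)).add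
    ((PolyGrowth.const 2).mul (hA.mul hS)))
  have h1 := hint (hA.mul hD)
  have h0 := hint (hA.pow 2)
  have hAneg : ∀ B a, A (B, -a) = A (B, a) := fun B a => by simp [A]
  have hDneg : ∀ B a, D (B, -a) = -D (B, a) := fun B a => by simp [D]
  have hdneg : ∀ B a, d (B, -a) = d (B, a) := fun B a => rfl
  have hSneg : ∀ B a, S (B, -a) = S (B, a) := fun B a => rfl
  have hwneg : ∀ B a, w (B, -a) = w (B, a) := fun B a => by simp [w, gaussianWeight]
  have i3 : ∫ x, D x * S x * d x * w x = 0 := integral_eq_zero_of_odd_snd h3 fun B a => by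
    rw [hDneg, hdneg, hSneg, hwneg]; ring
  have i1 : ∫ x, A x * D x * d x * w x = 0 := integral_eq_zero_of_odd_snd h1 fun B a => by
    rw [hDneg, hdneg, hAneg, hwneg]; ring
  refine ⟨∫ x, S x ^ 2 * d x * w x, ∫ x, (4 * D x ^ 2 + 2 * (A x * S x)) * d x * w x,
    ∫ x, A x ^ 2 * d x * w x, ?_, fun t => ?_⟩
  · have : (volume : Measure (AffineParam p)).IsOpenPosMeasure :=
      Measure.prod.instIsOpenPosMeasure
    refine integral_pos_of_integrable_nonneg_nonzero
      (x := ((1 : Matrix (Fin p) (Fin p) ℝ), 0)) ?_ h4 (fun x => ?_) ?_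
    · exact ((hS.pow 2).mul hd).1.mul (continuous_gaussianWeight p _)
    · simp only [S, d, w, gaussianWeight, Pi.zero_apply]
      positivity
    · have hS1 : S ((1 : Matrix (Fin p) (Fin p) ℝ), 0) = 1 := by
        simp [S, Matrix.one_apply]
      have hd1 : d ((1 : Matrix (Fin p) (Fin p) ℝ), 0) = 1 := by
        have : (Matrix.of (1 : Matrix (Fin p) (Fin p) ℝ)).det = 1 := Matrix.det_one
        simp only [d]
        rw [this]; simp
      rw [hS1, hd1]
      simp [w, gaussianWeight, Real.exp_ne_zero]
  · have hexp : ∀ x : AffineParam p,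
        (∑ j, (x.2 j + (Matrix.of x.1).mulVec (Pi.single j₀ t) j) ^ 2) ^ 2 *
        Real.exp (-((n : ℝ) / 2) * (∑ j, (x.2 j) ^ 2)
          - ((n : ℝ) / 2) * Matrix.trace ((Matrix.of x.1)ᵀ * Matrix.of x.1)) *
        |(Matrix.of x.1).det| ^ (n - p - 1)
        = t ^ 4 * (S x ^ 2 * d x * w x) + 4 * t ^ 3 * (D x * S x * d x * w x)
          + t ^ 2 * ((4 * D x ^ 2 + 2 * (A x * S x)) * d x * w x)
          + 4 * t * (A x * D x * d x * w x) + A x ^ 2 * d x * w x := fun x => by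
      have hsq : ∑ j, (x.2 j + (Matrix.of x.1).mulVec (Pi.single j₀ t) j) ^ 2
          = A x + 2 * t * D x + t ^ 2 * S x := by
        simp only [A, D, S, Finset.mul_sum, ← Finset.sum_add_distrib]
        refine Finset.sum_congr rfl fun j _ => ?_
        simp only [Matrix.mulVec_single, Pi.smul_apply, Matrix.col_apply, Matrix.of_apply,
          MulOpposite.smul_eq_mul_unop, MulOpposite.unop_op]
        ring
      rw [hsq]
      simp only [d, w, gaussianWeight]
      ring
    have I4 := h4.const_mul (t ^ 4)
    have I3 := h3.const_mul (4 * t ^ 3)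
    have I2 := h2.const_mul (t ^ 2)
    have I1 := h1.const_mul (4 * t)
    have hsum := (((I4.add I3).add I2).add I1).add h0
    have hfub := integral_prod _ hsum
    unfold affineLbiIntegral
    refine Eq.trans (integral_congr_ae (.of_forall fun B => integral_congr_ae
      (.of_forall fun a => hexp (B, a)))) (hfub.symm.trans ?_)
    rw [← Measure.volume_eq_prod]
    rw [integral_add' (((I4.add I3).add I2).add I1) h0, integral_add' ((I4.add I3).add I2) I1,
      integral_add' (I4.add I3) I2, integral_add' I4 I3]
    simp only [integral_const_mul, i3, i1]
    ring

/-- there are constants `κ₁ > 0`, `κ₂`, `κ₃` (and `const`), depending only on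
`n` and `p`, with `I(z) = κ₁‖z‖⁴ + κ₂‖z‖² + κ₃` for every `z ∈ ℝ^p`; consequently for
standardized multivariate samples (`∑ᵢ zᵢ = 0`, `∑ᵢ zᵢzᵢ' = n I_p`) one has
`∑ᵢ I(zᵢ) = κ₁ ∑ᵢ ‖zᵢ‖⁴ + const`, so the LBI test under `ℝ^p × GL(p)` for the score
`p₀‖x‖⁴ + p₁‖x‖² + p₂` (`p₀ > 0`) rejects for large `∑ᵢ ‖zᵢ‖⁴`. -/
theorem lbi_multivariate_affine (p n : ℕ) (hp : 1 ≤ p) (hn : p + 2 ≤ n) :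
    ∃ κ₁ κ₂ κ₃ const : ℝ, 0 < κ₁ ∧
      (∀ z : Fin p → ℝ, affineLbiIntegral p n z
        = κ₁ * (∑ j, (z j) ^ 2) ^ 2 + κ₂ * (∑ j, (z j) ^ 2) + κ₃)
      ∧ (∀ Z : Fin n → Fin p → ℝ,
          (∀ j, ∑ i, Z i j = 0) →
          (∀ j k, ∑ i, Z i j * Z i k = if j = k then (n : ℝ) else 0) →
          (∑ i, affineLbiIntegral p n (Z i))
            = κ₁ * (∑ i, (∑ j, (Z i j) ^ 2) ^ 2) + const) := by
  have hn0 : 0 < n := by omega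
  obtain ⟨κ₁, κ₂, κ₃, hκ, hI⟩ := exists_affineLbiIntegral_single (p := p) hn0 ⟨0, hp⟩
  have hmain : ∀ z : Fin p → ℝ, affineLbiIntegral p n z
      = κ₁ * (∑ j, (z j) ^ 2) ^ 2 + κ₂ * (∑ j, (z j) ^ 2) + κ₃ := fun z => by
    have hz : 0 ≤ ∑ j, z j ^ 2 := by positivity
    have hnorm : Pi.single (⟨0, hp⟩ : Fin p) √(∑ j, z j ^ 2) ⬝ᵥ Pi.single ⟨0, hp⟩ √(∑ j, z j ^ 2)
        = z ⬝ᵥ z := by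
      rw [single_dotProduct, Pi.single_eq_same, Real.mul_self_sqrt hz]
      simp [dotProduct, pow_two]
    obtain ⟨H, hsymm, hH, hHz⟩ := exists_symm_orthogonal_mulVec_eq hnorm
    rw [← hHz, affineLbiIntegral_mulVec hsymm hH, hI, hHz,
      show √(∑ j, z j ^ 2) ^ 4 = (√(∑ j, z j ^ 2) ^ 2) ^ 2 by ring, Real.sq_sqrt hz]
  refine ⟨κ₁, κ₂, κ₃, κ₂ * (n * p) + n * κ₃, hκ, hmain, fun Z _ hcov => ?_⟩
  have hsum : ∑ i, ∑ j, Z i j ^ 2 = (n : ℝ) * p := by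
    rw [Finset.sum_comm]
    calc ∑ j, ∑ i, Z i j ^ 2 = ∑ _j : Fin p, (n : ℝ) :=
          Finset.sum_congr rfl fun j _ => by simpa [pow_two] using hcov j j
      _ = n * p := by simp [mul_comm]
  simp only [hmain, Finset.sum_add_distrib, ← Finset.mul_sum, hsum]
  simp
  ring
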